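/- arXiv:1306.1983 — 2 statements merged into one kernel-verified Lean document; each statement's English description precedes it below -/
import Mathlib

section
/- If the N-fan Σ is W-regular, then Pic_W(Σ) = A_{W,Σ₁}, i.e., the canonical embedding b_{W,Σ} : Pic_W(Σ) → A_{W,Σ₁} is surjective. -/
open Module

noncomputable section
open scoped Classical

namespace ToricStmt

variable {V : Type*} [AddCommGroup V] [Module ℝ V]

/-- The conic hull of a set: all finite linear combinations with nonnegative real
coefficients. -/
def coneHull (A : Set V) : Set V :=
  {x | ∃ (s : Finset V) (c : V → ℝ), (s : Set V) ⊆ A ∧ (∀ v ∈ s, 0 ≤ c v) ∧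
    x = ∑ v ∈ s, c v • v}

/-- `τ` is a face of `σ`. -/
def IsFaceOf (τ σ : Set V) : Prop :=
  ∃ u : Module.Dual ℝ V, (∀ x ∈ σ, 0 ≤ u x) ∧ τ = σ ∩ {x | u x = 0}

/-- A set is sharp if it contains no line. -/
def IsSharp (σ : Set V) : Prop :=
  ¬ ∃ p v : V, v ≠ 0 ∧ ∀ t : ℝ, p + t • v ∈ σ

section Polycones

variable {R : Type*} [CommSemiring R] [Module R V]

/-- A `W`-polycone: the conic hull of a finite subset of `W`. -/
def IsPolycone (W : Submodule R V) (σ : Set V) : Prop :=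
  ∃ A : Finset V, (A : Set V) ⊆ (W : Set V) ∧ σ = coneHull (A : Set V)

/-- A `W`-fan: a finite set of sharp `W`-polycones such that the intersection of any two
members is a face of each of them, and all faces of members are members. -/
def IsFan (W : Submodule R V) (F : Set (Set V)) : Prop :=
  F.Finite ∧ (∀ σ ∈ F, IsPolycone W σ ∧ IsSharp σ) ∧
    (∀ σ ∈ F, ∀ τ ∈ F, IsFaceOf (σ ∩ τ) σ) ∧
    ∀ σ ∈ F, ∀ τ : Set V, IsFaceOf τ σ → τ ∈ F

end Polycones

section RStructure

variable (R : Type*) [CommSemiring R] [Algebra R ℝ] [Module R V] [IsScalarTower R ℝ V]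

/-- `W` is an `R`-structure on `V` if the canonical map `ℝ ⊗_R W → V` is bijective. -/
def IsRStructure (W : Submodule R V) : Prop :=
  Function.Bijective (W.subtype.liftBaseChange ℝ)

end RStructure

section Picard

variable {R : Type*} [CommRing R] [Module R V]

/-- The submodule of the dual of `W` consisting of forms vanishing on `W ∩ σ`;
this encodes `σ^⊥ ∩ W*`. -/
def perpDual (W : Submodule R V) (σ : Set V) : Submodule R (Module.Dual R W) where
  carrier := {m | ∀ w : W, (w : V) ∈ σ → m w = 0}
  add_mem' := by
    intro a b ha hb w hw
    simp [ha w hw, hb w hw]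
  zero_mem' := by
    intro w hw
    simp
  smul_mem' := by
    intro c m hm w hw
    simp [hm w hw]

variable (W : Submodule R V) (F : Set (Set V))

/-- The submodule of families `(m_σ)_{σ∈Σ}` with every component in `σ^⊥ ∩ W*`. -/
def zeroSub : Submodule R (↥F → Module.Dual R W) :=
  Submodule.pi Set.univ fun σ : ↥F => perpDual W σ.1

/-- The module `P_{W,Σ}` of families `(m_σ + σ^∨)_{σ∈Σ}`. -/
abbrev PMod := (↥F → Module.Dual R W) ⧸ zeroSub W F

/-- Families `(m_σ)` with `m_σ - m_τ ∈ τ^⊥` whenever `τ` is a face of `σ`. -/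
def goodFam : Submodule R (↥F → Module.Dual R W) where
  carrier := {m | ∀ σ τ : ↥F, IsFaceOf (τ : Set V) (σ : Set V) →
    m σ - m τ ∈ perpDual W (τ : Set V)}
  add_mem' := by
    intro a b ha hb σ τ h
    have heq : (a + b) σ - (a + b) τ = (a σ - a τ) + (b σ - b τ) := by
      simp only [Pi.add_apply]; abel
    rw [heq]
    exact add_mem (ha σ τ h) (hb σ τ h)
  zero_mem' := by
    intro σ τ h
    simp only [Pi.zero_apply, sub_zero]; exact (perpDual W (τ : Set V)).zero_mem
  smul_mem' := by
    intro c m hm σ τ h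
    have heq : (c • m) σ - (c • m) τ = c • (m σ - m τ) := by
      simp only [Pi.smul_apply]; rw [smul_sub]
    rw [heq]
    exact Submodule.smul_mem _ c (hm σ τ h)

/-- The module of virtual polytopes `\overline{P}_{W,Σ}`, as a submodule of `P_{W,Σ}`. -/
def vpSub : Submodule R (PMod W F) := (goodFam W F).map (zeroSub W F).mkQ

/-- The diagonal map `W* → (W*)^Σ`. -/
def diagMap : Module.Dual R W →ₗ[R] (↥F → Module.Dual R W) :=
  LinearMap.pi fun _ => LinearMap.id

/-- The submodule `K_{W,Σ}` of `P_{W,Σ}`: the image of the diagonal. -/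
def kSub : Submodule R (PMod W F) :=
  LinearMap.range ((zeroSub W F).mkQ ∘ₗ diagMap W F)

/-- The Picard module `Pic_W(Σ) = \overline{P}_{W,Σ} / K_{W,Σ}`. -/
abbrev PicMod := ↥(vpSub W F) ⧸ ((kSub W F).comap (vpSub W F).subtype)

/-- The canonical surjection `e_{W,Σ}` from the virtual polytopes onto the Picard module. -/
def picQ : ↥(vpSub W F) →ₗ[R] PicMod W F :=
  Submodule.mkQ _

end Picard

section NSide

variable {V : Type*} [AddCommGroup V] [Module ℝ V]

/-- The set of 1-dimensional members of `Σ`. -/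
def raysOf (F : Set (Set V)) : Set (Set V) :=
  {ρ | ρ ∈ F ∧ Module.finrank ℝ (Submodule.span ℝ ρ) = 1}

/-- A `ℤ`-structure on `V`: the canonical map `ℝ ⊗_ℤ N → V` is bijective. -/
def IsZStructure (N : Submodule ℤ V) : Prop :=
  Function.Bijective (N.subtype.liftBaseChange ℝ)

/-- `x` is the `N`-minimal `N`-generator of the one-dimensional polycone `ρ`:
the minimal element of `(N ∩ ρ) \ {0}` for the ordering `x ≤ y ↔ x ∈ conv{0,y}`. -/
def IsMinGen (N : Submodule ℤ V) (ρ : Set V) (x : V) : Prop :=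
  x ∈ N ∧ x ∈ ρ ∧ x ≠ 0 ∧ ∀ y : V, y ∈ N → y ∈ ρ → y ≠ 0 → x ∈ segment ℝ 0 y

/-- The linear map `W* → S^ι`, `m ↦ (m (g i))_{i}`. -/
def evalFam {S : Type*} [CommSemiring S] {M : Type*} [AddCommMonoid M] [Module S M]
    {ι : Type*} (g : ι → M) : Module.Dual S M →ₗ[S] (ι → S) :=
  LinearMap.pi fun i => LinearMap.applyₗ (g i)

variable {R : Type*} [CommRing R] [Module R V]

/-- The module `A_{W,Σ₁}`: the cokernel of `c_{W,Σ₁} : W* → R^{Σ₁}`. -/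
abbrev AMod (W : Submodule R V) {ι : Type*} (g : ι → W) : Type _ :=
  (ι → R) ⧸ LinearMap.range (evalFam (S := R) g)

/-- The canonical projection `a_{W,Σ₁} : R^{Σ₁} → A_{W,Σ₁}`. -/
def aQ (W : Submodule R V) {ι : Type*} (g : ι → W) : (ι → R) →ₗ[R] AMod W g :=
  Submodule.mkQ _

/-- The class `α_ρ ∈ A_{W,Σ₁}` of the standard basis vector `δ_ρ`. -/
def alphaA (W : Submodule R V) {ι : Type*} (g : ι → W) (i : ι) : AMod W g :=
  aQ W g (Pi.single i 1)

/-- The submodule `A^σ_{W,Σ}` of `A_{W,Σ₁}` generated by the `α_ρ` with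
`ρ ∈ Σ₁ \ σ₁`. -/
def ASubmod (W : Submodule R V) (F : Set (Set V)) (g : ↥(raysOf F) → W) (σ : Set V) :
    Submodule R (AMod W g) :=
  Submodule.span R {x | ∃ ρ : ↥(raysOf F), ¬ IsFaceOf (ρ : Set V) σ ∧ x = alphaA W g ρ}

/-- The map `(W*)^Σ → R^{Σ₁}`, `(m_σ)_σ ↦ (m_ρ (ρ_N))_ρ`. -/
def dFam (W : Submodule R V) (F : Set (Set V)) (g : ↥(raysOf F) → W) :
    (↥F → Module.Dual R W) →ₗ[R] (↥(raysOf F) → R) :=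
  LinearMap.pi fun ρ : ↥(raysOf F) =>
    (LinearMap.applyₗ (g ρ)) ∘ₗ (LinearMap.proj (⟨ρ.1, ρ.2.1⟩ : ↥F))

/-- The image of the Picard module `Pic_W(Σ)` in `A_{W,Σ₁}` under the canonical
embedding `b_{W,Σ}`: the set of all `a((m_ρ(ρ_N))_ρ)` for face-compatible families
`(m_σ)_{σ∈Σ}` in `W*`. -/
def picInA (W : Submodule R V) (F : Set (Set V)) (g : ↥(raysOf F) → W) :
    Submodule R (AMod W g) :=
  (goodFam W F).map ((aQ W g) ∘ₗ (dFam W F g))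

/-- `F` is an `R`-basis of `W`. -/
def IsBasisSet (W : Submodule R V) (Fs : Set V) : Prop :=
  Fs ⊆ (W : Set V) ∧ LinearIndependent R ((↑) : Fs → V) ∧ Submodule.span R Fs = W

/-- A `W`-regular polycone: the conic hull of a subset of an `R`-basis of `W`. -/
def IsRegularPolycone (W : Submodule R V) (σ : Set V) : Prop :=
  ∃ E Fs : Set V, E ⊆ Fs ∧ IsBasisSet W Fs ∧ σ = coneHull E

/-- A simplicial polycone: the conic hull of a finite `ℝ`-linearly independent set. -/
def IsSimplicialPolycone (σ : Set V) : Prop :=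
  ∃ E : Set V, E.Finite ∧ LinearIndependent ℝ ((↑) : E → V) ∧ σ = coneHull E

end NSide

section Cones

variable {V : Type*} [AddCommGroup V] [Module ℝ V]

theorem mem_coneHull_singleton {e x : V} :
    x ∈ coneHull ({e} : Set V) ↔ ∃ t : ℝ, 0 ≤ t ∧ x = t • e := by
  constructor
  · rintro ⟨s, c, hs, hc, rfl⟩
    have hs' : s ⊆ {e} := by
      intro v hv
      simpa using hs hv
    rcases Finset.subset_singleton_iff.1 hs' with rfl | rfl
    · exact ⟨0, le_rfl, by simp⟩
    · exact ⟨c e, hc e (by simp), by simp⟩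
  · rintro ⟨t, ht, rfl⟩
    exact ⟨{e}, fun _ => t, by simp, by simp [ht], by simp⟩

theorem subset_coneHull (A : Set V) : A ⊆ coneHull A := fun e he =>
  ⟨{e}, fun _ => 1, by simpa using he, by simp, by simp⟩

theorem coneHull_mono {A B : Set V} (h : A ⊆ B) : coneHull A ⊆ coneHull B := by
  rintro x ⟨s, c, hs, hc, rfl⟩
  exact ⟨s, c, hs.trans h, hc, rfl⟩

/-- A linearly independent set admits a linear form with prescribed values. -/
theorem exists_dual_eq_on {S : Set V} (hS : LinearIndependent ℝ ((↑) : S → V)) (f : V → ℝ) :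
    ∃ u : Module.Dual ℝ V, ∀ x ∈ S, u x = f x := by
  have hS' : LinearIndepOn ℝ id S := hS
  refine ⟨(Basis.extend hS').constr ℝ fun x => f x, fun x hx => ?_⟩
  have h := (Basis.extend hS').constr_basis ℝ (fun y => f y) ⟨x, hS'.subset_extend _ hx⟩
  simpa using h

/-- A generator of the cone over a linearly independent set spans a face. -/
theorem isFaceOf_coneHull_singleton {E S : Set V} (hES : E ⊆ S)
    (hS : LinearIndependent ℝ ((↑) : S → V)) {e : V} (he : e ∈ E) :
    IsFaceOf (coneHull {e}) (coneHull E) := by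
  obtain ⟨u, hu⟩ := exists_dual_eq_on hS fun x => if x = e then 0 else 1
  have hu0 : ∀ x ∈ E, 0 ≤ u x := fun x hx => by
    rw [hu x (hES hx)]
    split_ifs <;> norm_num
  refine ⟨u, ?_, ?_⟩
  · rintro x ⟨s, c, hs, hc, rfl⟩
    rw [map_sum]
    refine Finset.sum_nonneg fun v hv => ?_
    rw [map_smul]
    exact mul_nonneg (hc v hv) (hu0 v (hs hv))
  · ext x
    constructor
    · intro hx
      refine ⟨coneHull_mono (by simpa using he) hx, ?_⟩
      obtain ⟨t, -, rfl⟩ := mem_coneHull_singleton.1 hx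
      simp [hu e (hES he)]
    · rintro ⟨⟨s, c, hs, hc, rfl⟩, hx⟩
      have hx' : ∑ v ∈ s, c v * u v = 0 := by simpa using hx
      have hz := (Finset.sum_eq_zero_iff_of_nonneg
        fun v hv => mul_nonneg (hc v hv) (hu0 v (hs hv))).1 hx'
      have hz' : ∀ v ∈ s, v ≠ e → c v = 0 := fun v hv hve => by
        simpa [hu v (hES (hs hv)), hve] using hz v hv
      rw [mem_coneHull_singleton]
      by_cases hes : e ∈ s
      · refine ⟨c e, hc e hes, Finset.sum_eq_single_of_mem e hes fun v hv hve => ?_⟩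
        rw [hz' v hv hve, zero_smul]
      · refine ⟨0, le_rfl, ?_⟩
        rw [zero_smul]
        refine Finset.sum_eq_zero fun v hv => ?_
        rw [hz' v hv (fun h => hes (h ▸ hv)), zero_smul]

theorem finrank_span_coneHull_singleton {e : V} (he : e ≠ 0) :
    Module.finrank ℝ (Submodule.span ℝ (coneHull {e})) = 1 := by
  have : Submodule.span ℝ (coneHull {e}) = Submodule.span ℝ {e} := by
    refine le_antisymm (Submodule.span_le.2 fun x hx => ?_)
      (Submodule.span_mono (subset_coneHull _))
    obtain ⟨t, -, rfl⟩ := mem_coneHull_singleton.1 hx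
    exact Submodule.smul_mem _ _ (Submodule.mem_span_singleton_self e)
  rw [this, finrank_span_singleton he]

/-- A one-dimensional face of the cone over a linearly independent set is spanned by one of
the generators. -/
theorem exists_eq_coneHull_singleton {E S ρ : Set V} (hES : E ⊆ S)
    (hS : LinearIndependent ℝ ((↑) : S → V)) (hρ : IsFaceOf ρ (coneHull E))
    (hdim : Module.finrank ℝ (Submodule.span ℝ ρ) = 1) {x : V} (hxρ : x ∈ ρ) (hx0 : x ≠ 0) :
    ∃ e ∈ E, ρ = coneHull {e} := by
  obtain ⟨u, hu, rfl⟩ := hρ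
  obtain ⟨⟨s, c, hs, hc, rfl⟩, hux⟩ := hxρ
  have hx' : ∑ v ∈ s, c v * u v = 0 := by simpa using hux
  have huE : ∀ v ∈ E, 0 ≤ u v := fun v hv => hu v (subset_coneHull E hv)
  have hz := (Finset.sum_eq_zero_iff_of_nonneg
    fun v hv => mul_nonneg (hc v hv) (huE v (hs hv))).1 hx'
  obtain ⟨e, hes, hce⟩ := Finset.exists_ne_zero_of_sum_ne_zero hx0
  have hce' : c e ≠ 0 := fun h => hce (by rw [h, zero_smul])
  have hue : u e = 0 := (mul_eq_zero.1 (hz e hes)).resolve_left hce'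
  have heE : e ∈ E := hs hes
  have he0 : e ≠ 0 := fun h => hce (by rw [h, smul_zero])
  have heρ : e ∈ coneHull E ∩ {x | u x = 0} := ⟨subset_coneHull E heE, hue⟩
  refine ⟨e, heE, Set.Subset.antisymm (fun y hy => ?_) fun y hy => ?_⟩
  · obtain ⟨t, ht⟩ := (finrank_eq_one_iff_of_nonzero'
      (⟨e, Submodule.subset_span heρ⟩ : Submodule.span ℝ (coneHull E ∩ {x | u x = 0}))
      (fun h => he0 (congrArg Subtype.val h))).1 hdim ⟨y, Submodule.subset_span hy⟩
    have hty : y = t • e := (congrArg Subtype.val ht).symm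
    refine mem_coneHull_singleton.2 ⟨t, ?_, hty⟩
    obtain ⟨w, hw⟩ := exists_dual_eq_on hS fun x => if x = e then 1 else 0
    have hwy : w y = t := by simp [hty, hw e (hES heE)]
    rw [← hwy]
    obtain ⟨s', c', hs', hc', rfl⟩ := hy.1
    rw [map_sum]
    refine Finset.sum_nonneg fun v hv => ?_
    rw [map_smul, hw v (hES (hs' hv))]
    refine mul_nonneg (hc' v hv) ?_
    split_ifs <;> norm_num
  · obtain ⟨t, ht, rfl⟩ := mem_coneHull_singleton.1 hy
    exact ⟨coneHull_mono (by simpa using heE) hy, by simp [hue]⟩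

/-- The minimal generator of a ray is a primitive lattice vector. -/
theorem IsMinGen.isUnit_of_eq_smul {N : Submodule ℤ V} {e x y : V}
    (hx : IsMinGen N (coneHull {e}) x) (hy : y ∈ N) {d : ℤ} (hd : x = d • y) : IsUnit d := by
  obtain ⟨-, hxe, hx0, hmin⟩ := hx
  have key : ∀ (d : ℤ) (y : V), y ∈ N → x = d • y → 0 < d → d = 1 := by
    intro d y hy hd hpos
    have hd' : x = (d : ℝ) • y := by rw [hd, Int.cast_smul_eq_zsmul]
    have hdR : (0 : ℝ) < d := by exact_mod_cast hpos
    have hyx : y = (d : ℝ)⁻¹ • x := by rw [hd', inv_smul_smul₀ hdR.ne']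
    have hy0 : y ≠ 0 := fun h => hx0 (by rw [hd, h, smul_zero])
    have hye : y ∈ coneHull {e} := by
      obtain ⟨t, ht, rfl⟩ := mem_coneHull_singleton.1 hxe
      exact mem_coneHull_singleton.2 ⟨(d : ℝ)⁻¹ * t, by positivity, by rw [hyx, smul_smul]⟩
    obtain ⟨a, b, ha, hb, hab, hxy⟩ := hmin y hy hye hy0
    have hbd : b • y = (d : ℝ) • y := by rw [← hd', ← hxy]; simp
    have hbd' : b = d := smul_left_injective ℝ hy0 hbd
    have : (d : ℝ) ≤ 1 := by linarith
    have : d ≤ 1 := by exact_mod_cast this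
    omega
  rcases lt_trichotomy d 0 with h | h | h
  · have := key (-d) (-y) (N.neg_mem hy) (by simpa using hd) (by omega)
    exact Int.isUnit_iff.2 (by omega)
  · exact absurd (by rw [hd, h, zero_smul]) hx0
  · exact Int.isUnit_iff.2 (Or.inl (key d y hy hd h))

end Cones

section BasisSets

variable {V R : Type*} [AddCommGroup V] [CommRing R] [Module R V]

/-- The basis of `W` given by a set that is an `R`-basis of `W`. -/
def IsBasisSet.basis {W : Submodule R V} {S : Set V} (hS : IsBasisSet W S) : Basis S R W :=
  (Basis.span hS.2.1).map (LinearEquiv.ofEq _ _ (by rw [Subtype.range_coe, hS.2.2]))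

theorem IsBasisSet.coe_basis {W : Submodule R V} {S : Set V} (hS : IsBasisSet W S) (x : S) :
    (hS.basis x : V) = x := by
  simp [IsBasisSet.basis, Basis.span_apply]

end BasisSets

section Structures

variable {V : Type*} [AddCommGroup V] [Module ℝ V]

/-- A primitive vector of a free module of finite rank over a principal ideal domain takes the
value one under some linear form. -/
theorem exists_dual_eq_one {A M : Type*} [CommRing A] [IsDomain A] [IsPrincipalIdealRing A]
    [AddCommGroup M] [Module A M] [Module.Free A M] [Module.Finite A M] (x : M)
    (hx : ∀ (d : A) (y : M), x = d • y → IsUnit d) : ∃ f : Module.Dual A M, f x = 1 := by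
  let I : Ideal A := LinearMap.range (Module.Dual.eval A M x)
  obtain ⟨d, hd⟩ := (IsPrincipalIdealRing.principal I).principal
  have hdvd : ∀ f : Module.Dual A M, d ∣ f x := fun f => by
    rw [← Ideal.mem_span_singleton, ← Ideal.submodule_span_eq, ← hd]
    exact ⟨f, rfl⟩
  let b := Module.Free.chooseBasis A M
  choose c hc using fun i => hdvd (b.coord i)
  have hu : IsUnit d := hx d (∑ i, c i • b i) <| by
    rw [Finset.smul_sum]
    conv_lhs => rw [← b.sum_repr x]
    refine Finset.sum_congr rfl fun i _ => ?_
    rw [smul_smul, ← hc i, Basis.coord_apply]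
  have hI : I = ⊤ := by
    rw [hd, Ideal.submodule_span_eq, Ideal.span_singleton_eq_top]
    exact hu
  have h1 : (1 : A) ∈ I := hI ▸ Submodule.mem_top
  obtain ⟨f, hf⟩ := h1
  exact ⟨f, hf⟩

/-- An integral form on a submodule of a `ℤ`-structure extends to a real form. -/
theorem exists_dual_extend {N : Submodule ℤ V} (hN : IsZStructure N) {L : Submodule ℤ V}
    (hL : L ≤ N) (f : Module.Dual ℤ L) :
    ∃ u : Module.Dual ℝ V, ∀ x : L, u x = f x := by
  have hinj : Function.Injective (L.subtype.liftBaseChange ℝ) := by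
    have h1 : L.subtype.liftBaseChange ℝ =
        N.subtype.liftBaseChange ℝ ∘ₗ (Submodule.inclusion hL).baseChange ℝ := by
      ext x
      simp
    rw [h1, LinearMap.coe_comp]
    exact hN.1.comp (Module.Flat.lTensor_preserves_injective_linearMap _
      (Submodule.inclusion_injective hL))
  obtain ⟨p, hp⟩ := LinearMap.exists_leftInverse_of_injective _ (LinearMap.ker_eq_bot.2 hinj)
  refine ⟨((Algebra.linearMap ℤ ℝ ∘ₗ f).liftBaseChange ℝ) ∘ₗ p, fun x => ?_⟩
  have hx : p x = (1 : ℝ) ⊗ₜ[ℤ] x := by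
    have := LinearMap.congr_fun hp ((1 : ℝ) ⊗ₜ[ℤ] x)
    simpa using this
  simp [hx]

variable {R : Type*} [CommRing R] [Algebra R ℝ] [Module R V] [IsScalarTower R ℝ V]

/-- The `R`-module generated by a `ℤ`-structure is an `R`-structure. -/
theorem injective_liftBaseChange_span {N : Submodule ℤ V} (hN : IsZStructure N)
    {W : Submodule R V} (hWN : W = Submodule.span R (N : Set V)) :
    Function.Injective (W.subtype.liftBaseChange ℝ) := by
  have hNW : ∀ x ∈ N, x ∈ W := fun x hx => hWN ▸ Submodule.subset_span hx
  let i : N →ₗ[ℤ] W := (N.subtype.toAddMonoidHom.codRestrict W fun x => hNW x x.2).toIntLinearMap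
  let j : N →ₗ[ℤ] TensorProduct R ℝ W :=
    ((TensorProduct.mk R ℝ W 1).toAddMonoidHom.comp i.toAddMonoidHom).toIntLinearMap
  have hj : ∀ (x : V) (hx : x ∈ N), j ⟨x, hx⟩ = (1 : ℝ) ⊗ₜ[R] (⟨x, hNW x hx⟩ : W) :=
    fun x hx => rfl
  let φ := j.liftBaseChange ℝ
  have hcomp : W.subtype.liftBaseChange ℝ ∘ₗ φ = N.subtype.liftBaseChange ℝ := by
    ext x
    simp [φ, hj x.1 x.2]
  have hφ : Function.Surjective φ := by
    have h1 : ∀ x (hx : x ∈ W), (1 : ℝ) ⊗ₜ[R] (⟨x, hx⟩ : W) ∈ LinearMap.range φ := by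
      intro x hx
      have hx' : x ∈ Submodule.span R (N : Set V) := hWN ▸ hx
      induction hx' using Submodule.span_induction with
      | mem x h => exact ⟨(1 : ℝ) ⊗ₜ[ℤ] ⟨x, h⟩, by simp [φ, hj x h]⟩
      | zero =>
        have : (⟨0, hx⟩ : W) = 0 := rfl
        rw [this, TensorProduct.tmul_zero]
        exact Submodule.zero_mem _
      | add a b ha hb iha ihb =>
        have ha' : a ∈ W := hWN ▸ ha
        have hb' : b ∈ W := hWN ▸ hb
        have : (⟨a + b, hx⟩ : W) = ⟨a, ha'⟩ + ⟨b, hb'⟩ := rfl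
        rw [this, TensorProduct.tmul_add]
        exact Submodule.add_mem _ (iha ha') (ihb hb')
      | smul r a ha iha =>
        have ha' : a ∈ W := hWN ▸ ha
        have : (⟨r • a, hx⟩ : W) = r • ⟨a, ha'⟩ := rfl
        rw [this, TensorProduct.tmul_smul, ← algebraMap_smul ℝ r]
        exact Submodule.smul_mem _ _ (iha ha')
    rw [← LinearMap.range_eq_top, eq_top_iff]
    rintro z -
    induction z using TensorProduct.induction_on with
    | zero => exact Submodule.zero_mem _
    | add a b ha hb => exact Submodule.add_mem _ ha hb
    | tmul a w =>
      have : a ⊗ₜ[R] w = a • ((1 : ℝ) ⊗ₜ[R] w) := by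
        rw [TensorProduct.smul_tmul', smul_eq_mul, mul_one]
      rw [this]
      exact Submodule.smul_mem _ _ (h1 w.1 w.2)
  refine Function.Injective.of_comp_right ?_ hφ
  rw [← LinearMap.coe_comp, hcomp]
  exact hN.1

/-- A basis of an `R`-structure is linearly independent over `ℝ`. -/
theorem IsBasisSet.linearIndependent_real {W : Submodule R V}
    (hW : Function.Injective (W.subtype.liftBaseChange ℝ)) {S : Set V} (hS : IsBasisSet W S) :
    LinearIndependent ℝ ((↑) : S → V) := by
  have h := (hS.basis.baseChange ℝ).linearIndependent.map' _ (LinearMap.ker_eq_bot.2 hW)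
  have heq : ⇑(W.subtype.liftBaseChange ℝ) ∘ ⇑(hS.basis.baseChange ℝ) = ((↑) : S → V) := by
    ext x
    simp [hS.coe_basis]
  rw [← heq]
  exact h

/-- An element of `W` on a ray is an `R`-multiple of the minimal generator of the ray. -/
theorem IsMinGen.exists_eq_smul {N : Submodule ℤ V} (hN : IsZStructure N)
    {W : Submodule R V} (hWN : W = Submodule.span R (N : Set V)) {e x : V} (he : e ∈ W)
    (hx : IsMinGen N (coneHull {e}) x) : ∃ a : R, e = a • x := by
  obtain ⟨T, hTN, heT⟩ := Submodule.mem_span_finite_of_mem_span (hWN ▸ he)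
  let L : Submodule ℤ V := Submodule.span ℤ (insert x (T : Set V))
  have hLN : L ≤ N := Submodule.span_le.2 (Set.insert_subset hx.1 hTN)
  have hxL : x ∈ L := Submodule.subset_span (Set.mem_insert _ _)
  have : Module.Finite ℤ L :=
    Module.Finite.span_of_finite ℤ ((Finset.finite_toSet T).insert x)
  have : IsAddTorsionFree V := .of_isTorsionFree ℝ V
  obtain ⟨f, hf⟩ := exists_dual_eq_one (A := ℤ) (⟨x, hxL⟩ : L) fun d y hy =>
    hx.isUnit_of_eq_smul (hLN y.2) (congrArg Subtype.val hy)
  obtain ⟨u, hu⟩ := exists_dual_extend hN hLN f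
  have hue : ∃ a : R, u e = algebraMap R ℝ a := by
    clear he hx
    induction heT using Submodule.span_induction with
    | mem y hy =>
      exact ⟨(f ⟨y, Submodule.subset_span (Set.mem_insert_of_mem _ hy)⟩ : ℤ), by
        rw [map_intCast]; exact hu ⟨y, Submodule.subset_span (Set.mem_insert_of_mem _ hy)⟩⟩
    | zero => exact ⟨0, by simp⟩
    | add y z _ _ hy hz =>
      obtain ⟨a, ha⟩ := hy
      obtain ⟨b, hb⟩ := hz
      exact ⟨a + b, by rw [map_add, map_add, ha, hb]⟩
    | smul r y _ hy =>
      obtain ⟨a, ha⟩ := hy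
      exact ⟨r * a, by rw [← algebraMap_smul ℝ r y, map_smul, ha, map_mul, smul_eq_mul]⟩
  obtain ⟨a, ha⟩ := hue
  obtain ⟨t, -, hxt⟩ := mem_coneHull_singleton.1 hx.2.1
  have hux : u x = 1 := by rw [hu ⟨x, hxL⟩, hf, Int.cast_one]
  have hta : algebraMap R ℝ a * t = 1 := by
    rw [← ha, mul_comm, ← smul_eq_mul, ← map_smul, ← hxt, hux]
  refine ⟨a, ?_⟩
  rw [← algebraMap_smul ℝ a x, hxt, smul_smul, hta, one_smul]

/-- If `w ∈ W` lies in the cone over part of a basis of `W`, then a linear form on `W` that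
vanishes on this part vanishes at `w`. -/
theorem IsBasisSet.apply_eq_zero_of_mem_coneHull (hinj : Function.Injective (algebraMap R ℝ))
    {W : Submodule R V} {S E : Set V} (hS : IsBasisSet W S)
    (hSR : LinearIndependent ℝ ((↑) : S → V)) (hES : E ⊆ S) (m : Module.Dual R W)
    (hm : ∀ x : W, (x : V) ∈ E → m x = 0) (w : W) (hw : (w : V) ∈ coneHull E) : m w = 0 := by
  have hwsum : (w : V) = ∑ i ∈ (hS.basis.repr w).support,
      algebraMap R ℝ (hS.basis.repr w i) • (i : V) := by
    conv_lhs => rw [← hS.basis.linearCombination_repr w]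
    simp [Finsupp.linearCombination_apply, Finsupp.sum, hS.coe_basis]
  have hcoef : ∀ i : S, (i : V) ∉ E → hS.basis.repr w i = 0 := by
    intro i hi
    obtain ⟨u, hu⟩ := exists_dual_eq_on hSR fun x => if x = i then 1 else 0
    have h1 : u w = 0 := by
      obtain ⟨s, c, hs, -, hsum⟩ := hw
      rw [hsum, map_sum]
      refine Finset.sum_eq_zero fun v hv => ?_
      have hvi : v ≠ i := fun h => hi (h ▸ hs hv)
      rw [map_smul, hu v (hES (hs hv)), if_neg hvi, smul_zero]
    by_contra h0
    have h2 : u w = algebraMap R ℝ (hS.basis.repr w i) := by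
      rw [hwsum, map_sum, Finset.sum_eq_single_of_mem i (Finsupp.mem_support_iff.2 h0)]
      · rw [map_smul, hu i i.2]
        simp
      · intro j _ hj
        have : (j : V) ≠ i := fun h => hj (Subtype.ext h)
        rw [map_smul, hu j j.2, if_neg this, smul_zero]
    exact h0 (hinj (by rw [← h2, h1, map_zero]))
  rw [← hS.basis.linearCombination_repr w, Finsupp.linearCombination_apply, map_finsuppSum]
  refine Finset.sum_eq_zero fun i _ => ?_
  beta_reduce
  rw [map_smul]
  by_cases hi : (i : V) ∈ E
  · rw [hm _ (by rwa [hS.coe_basis]), smul_zero]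
  · rw [hcoef i hi, zero_smul]

end Structures

/-- If the `N`-fan `Σ` is `W`-regular then `Pic_W(Σ) = A_{W,Σ₁}`,
i.e. the canonical embedding `b_{W,Σ}` is surjective. -/
theorem picInA_eq_top_of_regular
    {V : Type*} [AddCommGroup V] [Module ℝ V] [FiniteDimensional ℝ V]
    {R : Type*} [CommRing R] [IsDomain R] [IsPrincipalIdealRing R]
    [Algebra R ℝ] (hinj : Function.Injective (algebraMap R ℝ))
    [Module R V] [IsScalarTower R ℝ V]
    (N : Submodule ℤ V) (hN : IsZStructure N)
    (W : Submodule R V) (hWN : W = Submodule.span R (N : Set V))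
    (F : Set (Set V)) (hF : IsFan N F)
    (g : ↥(raysOf F) → W) (hg : ∀ ρ : ↥(raysOf F), IsMinGen N (ρ : Set V) ((g ρ : W) : V))
    (hreg : ∀ σ ∈ F, IsRegularPolycone W σ) :
    picInA W F g = ⊤ := by
  have hW := injective_liftBaseChange_span hN hWN
  have hray : ∀ E S : Set V, E ⊆ S → IsBasisSet W S → coneHull E ∈ F → ∀ e ∈ E,
      coneHull {e} ∈ raysOf F := fun E S hES hS hE e he =>
    have hSR := hS.linearIndependent_real hW
    ⟨hF.2.2.2 _ hE _ (isFaceOf_coneHull_singleton hES hSR he),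
      finrank_span_coneHull_singleton (hSR.ne_zero ⟨e, hES he⟩)⟩
  have hmul : ∀ (e : V) (_ : e ∈ W) (h : coneHull {e} ∈ raysOf F),
      ∃ a : R, e = a • (g ⟨_, h⟩ : V) := fun e he h =>
    (hg ⟨_, h⟩).exists_eq_smul hN hWN he
  rw [eq_top_iff]
  rintro z -
  obtain ⟨r, rfl⟩ := Submodule.mkQ_surjective _ z
  have hm : ∀ σ : F, ∃ m : Module.Dual R W, ∀ ρ : raysOf F, (ρ : Set V) ⊆ σ →
      m (g ρ) = r ρ := by
    rintro ⟨σ, hσ⟩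
    obtain ⟨E, S, hES, hS, rfl⟩ := hreg σ hσ
    have hSR := hS.linearIndependent_real hW
    refine ⟨hS.basis.constr R fun e => if h : coneHull {(e : V)} ∈ raysOf F then
      (hmul e (hS.1 e.2) h).choose * r ⟨_, h⟩ else 0, ?_⟩
    rintro ⟨ρ, hρ⟩ hρσ
    have hface : IsFaceOf ρ (coneHull E) := by
      have := hF.2.2.1 _ hσ _ hρ.1
      rwa [Set.inter_eq_self_of_subset_right hρσ] at this
    obtain ⟨-, hgρ, hg0, -⟩ := hg ⟨ρ, hρ⟩
    obtain ⟨e, heE, rfl⟩ := exists_eq_coneHull_singleton hES hSR hface hρ.2 hgρ hg0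
    have ha := (hmul e (hS.1 (hES heE)) hρ).choose_spec
    set a := (hmul e (hS.1 (hES heE)) hρ).choose
    have ha0 : a ≠ 0 := fun h => hSR.ne_zero ⟨e, hES heE⟩ (by
      change e = 0
      rw [ha, h, zero_smul])
    have hbe : hS.basis ⟨e, hES heE⟩ = a • g ⟨_, hρ⟩ :=
      Subtype.ext (by rw [hS.coe_basis]; exact ha)
    refine mul_left_cancel₀ ha0 ?_
    rw [← smul_eq_mul, ← map_smul, ← hbe, Basis.constr_basis, dif_pos hρ]
  choose m hm using hm
  refine ⟨m, fun σ τ hτσ w hw => ?_, ?_⟩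
  · obtain ⟨E, S, hES, hS, hτ⟩ := hreg τ τ.2
    rw [hτ] at hw
    refine hS.apply_eq_zero_of_mem_coneHull hinj (hS.linearIndependent_real hW) hES _
      (fun x hx => ?_) w hw
    have hx' := hray E S hES hS (hτ ▸ τ.2) x hx
    obtain ⟨a, ha⟩ := hmul x x.2 hx'
    have hxτ : coneHull {(x : V)} ⊆ (τ : Set V) := by
      rw [hτ]
      exact coneHull_mono (by simpa using hx)
    have hτσ' : (τ : Set V) ⊆ σ := by
      obtain ⟨u, -, h⟩ := hτσ
      exact h ▸ Set.inter_subset_left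
    have hxg : x = a • g ⟨_, hx'⟩ := Subtype.ext ha
    rw [hxg, map_smul, LinearMap.sub_apply, hm σ ⟨_, hx'⟩ (hxτ.trans hτσ'),
      hm τ ⟨_, hx'⟩ hxτ, sub_self, smul_zero]
  · have : dFam W F g m = r := by
      ext ρ
      exact hm ⟨ρ.1, ρ.2.1⟩ ρ subset_rfl
    rw [LinearMap.comp_apply, this]
    rfl

end ToricStmt
end
end

section
/- Suppose B ⊆ A is a subgroup that is big (A/B is a finite group) and small (B ⊆ Pic(Σ)), and let σ ∈ Σ. Then the B-graded ring S_{B,σ} = ⊕_{α∈B} S_{σ,α} is strongly graded: for all α, β ∈ B, the degree-(α+β) component (S_{B,σ})_{α+β} equals the additive subgroup generated by the products of elements of (S_{B,σ})_α with elements of (S_{B,σ})_β. -/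
open Module

noncomputable section
open scoped Classical

namespace ToricStmt

variable {V : Type*} [AddCommGroup V] [Module ℝ V]

section Cox

variable {V : Type*} [AddCommGroup V] [Module ℝ V]

/-- The degree in `A_{Σ₁}` of an exponent vector of a monomial of the Cox ring. -/
def expDeg (N : Submodule ℤ V) {F : Set (Set V)} (gN : ↥(raysOf F) → N)
    (n : ↥(raysOf F) →₀ ℕ) : AMod N gN :=
  aQ N gN fun ρ => (n ρ : ℤ)

/-- The polynomial `x` in the Cox ring is homogeneous of degree `α`. -/
def CoxHomog (N : Submodule ℤ V) {F : Set (Set V)} (gN : ↥(raysOf F) → N)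
    (R : Type*) [CommRing R] (α : AMod N gN) (x : MvPolynomial ↥(raysOf F) R) : Prop :=
  ∀ n ∈ x.support, expDeg N gN n = α

/-- The exponent vector of the monomial `Ẑ_σ = ∏_{ρ ∈ Σ₁ \ σ₁} Z_ρ`. -/
def hatExp (F : Set (Set V)) [Fintype ↥(raysOf F)] (σ : Set V) : ↥(raysOf F) →₀ ℕ :=
  Finsupp.equivFunOnFinite.symm fun ρ => if IsFaceOf (ρ : Set V) σ then 0 else 1

/-- The monomial `Ẑ_σ = ∏_{ρ ∈ Σ₁ \ σ₁} Z_ρ` of the Cox ring. -/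
def hatZ (F : Set (Set V)) [Fintype ↥(raysOf F)] (R : Type*) [CommRing R] (σ : Set V) :
    MvPolynomial ↥(raysOf F) R :=
  MvPolynomial.monomial (hatExp F σ) (1 : R)

/-- The degree-`α` component `S_{σ,α}` of the localization `S_σ` of the Cox ring at
`Ẑ_σ`: the fractions `x / Ẑ_σ^k` with `x` homogeneous of degree `α + k·deg(Ẑ_σ)`. -/
def locComponent (N : Submodule ℤ V) (F : Set (Set V)) [Fintype ↥(raysOf F)]
    (gN : ↥(raysOf F) → N) (R : Type*) [CommRing R] (σ : Set V) (α : AMod N gN) :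
    Set (Localization.Away (hatZ F R σ)) :=
  {y | ∃ (k : ℕ) (x : MvPolynomial ↥(raysOf F) R),
    CoxHomog N gN R (α + k • expDeg N gN (hatExp F σ)) x ∧
    y * algebraMap (MvPolynomial ↥(raysOf F) R) (Localization.Away (hatZ F R σ))
        (hatZ F R σ ^ k)
      = algebraMap (MvPolynomial ↥(raysOf F) R) (Localization.Away (hatZ F R σ)) x}

end Cox
section Homogeneous

variable {V : Type*} [AddCommGroup V] [Module ℝ V] (N : Submodule ℤ V) {F : Set (Set V)}
  (gN : ↥(raysOf F) → N)

lemma expDeg_add (n n' : ↥(raysOf F) →₀ ℕ) :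
    expDeg N gN (n + n') = expDeg N gN n + expDeg N gN n' := by
  unfold expDeg
  rw [← map_add]
  congr 1

lemma expDeg_zero : expDeg N gN 0 = 0 := by
  unfold expDeg
  rw [← map_zero (aQ N gN)]
  congr 1

lemma expDeg_nsmul (k : ℕ) (n : ↥(raysOf F) →₀ ℕ) :
    expDeg N gN (k • n) = k • expDeg N gN n := by
  induction k with
  | zero => simp [expDeg_zero]
  | succ k ih => rw [succ_nsmul, succ_nsmul, expDeg_add, ih]

variable {N gN} in
/-- A degree in the Picard group is represented by an integer vector vanishing on the rays
of `σ`. -/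
lemma exists_aQ_eq_of_mem_picInA (hg : ∀ ρ : ↥(raysOf F), ((gN ρ : N) : V) ∈ (ρ : Set V))
    {σ : Set V} (hσ : σ ∈ F) {α : AMod N gN}
    (hα : α ∈ picInA N F gN) :
    ∃ e : ↥(raysOf F) → ℤ, aQ N gN e = α ∧
      ∀ ρ : ↥(raysOf F), IsFaceOf (ρ : Set V) σ → e ρ = 0 := by
  obtain ⟨m, hm, rfl⟩ := hα
  refine ⟨dFam N F gN m - evalFam gN (m ⟨σ, hσ⟩), ?_, fun ρ hρ => ?_⟩
  · have h : aQ N gN (evalFam gN (m ⟨σ, hσ⟩)) = 0 :=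
      (Submodule.Quotient.mk_eq_zero _).mpr ⟨_, rfl⟩
    rw [map_sub, h, sub_zero]
    rfl
  · have h : (m ⟨σ, hσ⟩ - m ⟨ρ.1, ρ.2.1⟩) (gN ρ) = 0 :=
      hm ⟨σ, hσ⟩ ⟨ρ.1, ρ.2.1⟩ hρ (gN ρ) (hg ρ)
    rw [LinearMap.sub_apply] at h
    change m ⟨ρ.1, ρ.2.1⟩ (gN ρ) - m ⟨σ, hσ⟩ (gN ρ) = 0
    linarith

variable (R : Type*) [CommRing R]

lemma coxHomog_monomial (n : ↥(raysOf F) →₀ ℕ) (r : R) :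
    CoxHomog N gN R (expDeg N gN n) (MvPolynomial.monomial n r) := by
  intro n' hn'
  rw [Finset.mem_singleton.mp (MvPolynomial.support_monomial_subset hn')]

variable {N gN R}

lemma CoxHomog.mul {α β : AMod N gN} {x y : MvPolynomial ↥(raysOf F) R}
    (hx : CoxHomog N gN R α x) (hy : CoxHomog N gN R β y) :
    CoxHomog N gN R (α + β) (x * y) := by
  intro n hn
  obtain ⟨a, ha, b, hb, rfl⟩ := Finset.mem_add.mp (MvPolynomial.support_mul x y hn)
  rw [expDeg_add, hx a ha, hy b hb]

lemma CoxHomog.add {α : AMod N gN} {x y : MvPolynomial ↥(raysOf F) R}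
    (hx : CoxHomog N gN R α x) (hy : CoxHomog N gN R α y) :
    CoxHomog N gN R α (x + y) := by
  intro n hn
  rcases Finset.mem_union.mp (MvPolynomial.support_add hn) with h | h
  exacts [hx n h, hy n h]

lemma CoxHomog.neg {α : AMod N gN} {x : MvPolynomial ↥(raysOf F) R}
    (hx : CoxHomog N gN R α x) : CoxHomog N gN R α (-x) := by
  intro n hn
  rw [MvPolynomial.support_neg] at hn
  exact hx n hn

end Homogeneous

section LocComponent

variable {V : Type*} [AddCommGroup V] [Module ℝ V] {N : Submodule ℤ V} {F : Set (Set V)}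
  [Fintype ↥(raysOf F)] {gN : ↥(raysOf F) → N} {R : Type*} [CommRing R] {σ : Set V}

lemma hatZ_pow (k : ℕ) : hatZ F R σ ^ k = MvPolynomial.monomial (k • hatExp F σ) (1 : R) := by
  rw [hatZ, MvPolynomial.monomial_pow, one_pow]

lemma coxHomog_hatZ_pow (k : ℕ) :
    CoxHomog N gN R (k • expDeg N gN (hatExp F σ)) (hatZ F R σ ^ k) := by
  rw [hatZ_pow, ← expDeg_nsmul]
  exact coxHomog_monomial N gN R _ 1

lemma mul_mem_locComponent {α β : AMod N gN} {y z : Localization.Away (hatZ F R σ)}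
    (hy : y ∈ locComponent N F gN R σ α) (hz : z ∈ locComponent N F gN R σ β) :
    y * z ∈ locComponent N F gN R σ (α + β) := by
  obtain ⟨k, x, hx, hyx⟩ := hy
  obtain ⟨l, w, hw, hzw⟩ := hz
  refine ⟨k + l, x * w, ?_, ?_⟩
  · convert hx.mul hw using 1
    rw [add_nsmul]
    abel
  · rw [pow_add, map_mul, map_mul, ← hyx, ← hzw]
    ring

lemma add_mem_locComponent {α : AMod N gN} {y z : Localization.Away (hatZ F R σ)}
    (hy : y ∈ locComponent N F gN R σ α) (hz : z ∈ locComponent N F gN R σ α) :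
    y + z ∈ locComponent N F gN R σ α := by
  obtain ⟨k, x, hx, hyx⟩ := hy
  obtain ⟨l, w, hw, hzw⟩ := hz
  refine ⟨k + l, x * hatZ F R σ ^ l + w * hatZ F R σ ^ k, CoxHomog.add ?_ ?_, ?_⟩
  · convert hx.mul (coxHomog_hatZ_pow l) using 1
    rw [add_nsmul]
    abel
  · convert hw.mul (coxHomog_hatZ_pow k) using 1
    rw [add_nsmul]
    abel
  · rw [pow_add, map_add, map_mul, map_mul, map_mul, ← hyx, ← hzw]
    ring

lemma zero_mem_locComponent (α : AMod N gN) :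
    (0 : Localization.Away (hatZ F R σ)) ∈ locComponent N F gN R σ α :=
  ⟨0, 0, fun n hn => by simp at hn, by simp⟩

lemma neg_mem_locComponent {α : AMod N gN} {y : Localization.Away (hatZ F R σ)}
    (hy : y ∈ locComponent N F gN R σ α) : -y ∈ locComponent N F gN R σ α := by
  obtain ⟨k, x, hx, hyx⟩ := hy
  exact ⟨k, -x, hx.neg, by rw [neg_mul, hyx, map_neg]⟩

/-- If an integer vector vanishes on the rays of `σ`, then the corresponding Laurent monomial
is a homogeneous unit of the localization at `Ẑ_σ`. -/
lemma exists_unit_locComponent (R : Type*) [CommRing R] {e : ↥(raysOf F) → ℤ}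
    (he : ∀ ρ : ↥(raysOf F), IsFaceOf (ρ : Set V) σ → e ρ = 0) :
    ∃ u ∈ locComponent N F gN R σ (aQ N gN e),
      ∃ v ∈ locComponent N F gN R σ (-aQ N gN e), u * v = 1 := by
  set k : ℕ := ∑ ρ, (e ρ).natAbs
  have hle (ρ) : (e ρ).natAbs ≤ k :=
    Finset.single_le_sum (f := fun ρ => (e ρ).natAbs) (fun _ _ => Nat.zero_le _)
      (Finset.mem_univ ρ)
  have hhat (ρ) : 0 ≤ e ρ + k * (hatExp F σ ρ : ℤ) ∧ 0 ≤ -e ρ + k * (hatExp F σ ρ : ℤ) := by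
    have := hle ρ
    by_cases h : IsFaceOf (ρ : Set V) σ
    · simp [hatExp, h, he ρ h]
    · simp only [hatExp, Finsupp.equivFunOnFinite_symm_apply_apply, h, if_false]
      push_cast
      omega
  let n : ↥(raysOf F) →₀ ℕ :=
    Finsupp.equivFunOnFinite.symm fun ρ => (e ρ + k * (hatExp F σ ρ : ℤ)).toNat
  let n' : ↥(raysOf F) →₀ ℕ :=
    Finsupp.equivFunOnFinite.symm fun ρ => (-e ρ + k * (hatExp F σ ρ : ℤ)).toNat
  have hn (ρ) : (n ρ : ℤ) = e ρ + k * (hatExp F σ ρ : ℤ) := Int.toNat_of_nonneg (hhat ρ).1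
  have hn' (ρ) : (n' ρ : ℤ) = -e ρ + k * (hatExp F σ ρ : ℤ) := Int.toNat_of_nonneg (hhat ρ).2
  have hdeg : expDeg N gN n = aQ N gN e + k • expDeg N gN (hatExp F σ) := by
    unfold expDeg
    rw [← map_nsmul, ← map_add]
    congr 1
    ext ρ
    simp [hn]
  have hdeg' : expDeg N gN n' = -aQ N gN e + k • expDeg N gN (hatExp F σ) := by
    unfold expDeg
    rw [← map_nsmul, ← map_neg, ← map_add]
    congr 1
    ext ρ
    simp [hn']
  have hadd : n + n' = k • hatExp F σ + k • hatExp F σ := by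
    ext ρ
    have h := hn ρ
    have h' := hn' ρ
    simp only [Finsupp.add_apply, Finsupp.smul_apply, smul_eq_mul]
    zify
    linarith
  let s : Submonoid.powers (hatZ F R σ) := ⟨hatZ F R σ ^ k, k, rfl⟩
  refine ⟨IsLocalization.mk' _ (MvPolynomial.monomial n (1 : R)) s,
    ⟨k, _, hdeg ▸ coxHomog_monomial N gN R n 1, IsLocalization.mk'_spec _ _ s⟩,
    IsLocalization.mk' _ (MvPolynomial.monomial n' (1 : R)) s,
    ⟨k, _, hdeg' ▸ coxHomog_monomial N gN R n' 1, IsLocalization.mk'_spec _ _ s⟩, ?_⟩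
  rw [← IsLocalization.mk'_mul, IsLocalization.mk'_eq_iff_eq_mul, one_mul]
  congr 1
  simp only [s, Submonoid.coe_mul, hatZ_pow, MvPolynomial.monomial_mul, hadd]

end LocComponent

/-- Suppose `B ⊆ A` is a subgroup that is big (`A/B` is finite) and
small (`B ⊆ Pic(Σ)`), and let `σ ∈ Σ`. Then the `B`-graded ring
`S_{B,σ} = ⊕_{α∈B} S_{σ,α}` is strongly graded: for all `α, β ∈ B` the component
`S_{σ,α+β}` equals the additive subgroup generated by the products of elements of
`S_{σ,α}` with elements of `S_{σ,β}`. -/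
theorem locComponent_strongly_graded
    {V : Type*} [AddCommGroup V] [Module ℝ V] [FiniteDimensional ℝ V]
    (N : Submodule ℤ V) (hN : IsZStructure N)
    (F : Set (Set V)) (hF : IsFan N F) [Fintype ↥(raysOf F)]
    (gN : ↥(raysOf F) → N)
    (hg : ∀ ρ : ↥(raysOf F), IsMinGen N (ρ : Set V) ((gN ρ : N) : V))
    (B : AddSubgroup (AMod N gN))
    (hbig : Finite (AMod N gN ⧸ B))
    (hsmall : (B : Set (AMod N gN)) ⊆ (picInA N F gN : Set (AMod N gN)))
    (σ : Set V) (hσ : σ ∈ F)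
    (R : Type*) [CommRing R] :
    ∀ α ∈ B, ∀ β ∈ B,
      locComponent N F gN R σ (α + β) =
        ↑(AddSubgroup.closure {z : Localization.Away (hatZ F R σ) |
          ∃ x ∈ locComponent N F gN R σ α, ∃ y ∈ locComponent N F gN R σ β,
            z = x * y}) := by
  intro α hα β hβ
  apply Set.Subset.antisymm
  · intro z hz
    obtain ⟨e, rfl, he⟩ :=
      exists_aQ_eq_of_mem_picInA (fun ρ => (hg ρ).2.1) hσ (hsmall hα)
    obtain ⟨u, hu, v, hv, huv⟩ := exists_unit_locComponent (N := N) (gN := gN) R he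
    refine AddSubgroup.subset_closure ⟨u, hu, v * z, ?_, by rw [← mul_assoc, huv, one_mul]⟩
    have h := mul_mem_locComponent hv hz
    rwa [neg_add_cancel_left] at h
  · intro z hz
    induction hz using AddSubgroup.closure_induction with
    | mem z hz =>
      obtain ⟨x, hx, y, hy, rfl⟩ := hz
      exact mul_mem_locComponent hx hy
    | zero => exact zero_mem_locComponent _
    | add _ _ _ _ hx hy => exact add_mem_locComponent hx hy
    | neg _ _ hx => exact neg_mem_locComponent hx

end ToricStmt
end
end
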